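/- Let j ∈ ℤ, p ∈ [1,∞], C₀ > 0, and let V ≥ 0 satisfy e^{2V} − 1 ≤ 1/2. Let f be a Schwartz function on ℝ³ whose Fourier transform is supported in the annulus {ξ : (3/4)·2^j ≤ |ξ| ≤ (8/3)·2^j}. Let ψ be a smooth, Lebesgue measure-preserving diffeomorphism of ℝ³ such that ‖Dψ^{±1}‖_{L^∞} ≤ e^{V}, ‖Dψ^{±1} − I‖_{L^∞} ≤ e^{V} − 1, and ‖D²ψ^{±1}‖_{L^∞} ≤ C₀ 2^j (e^{V} − 1). Then there exists a constant C depending only on F and C₀ such that ‖(Λf)∘ψ − Λ(f∘ψ)‖_{L^p(ℝ³)} ≤ C e^{V}(e^{V} − 1) 2^j ‖f‖_{L^p(ℝ³)}. -/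

import Mathlib

open MeasureTheory
open scoped Real ENNReal FourierTransform SchwartzMap

noncomputable section

/-- `|ξ|_F² = ξ₁² + ξ₂² + F²ξ₃²`. -/
def normFsq (F : ℝ) (ξ : EuclideanSpace ℝ (Fin 3)) : ℝ :=
  ξ 0 ^ 2 + ξ 1 ^ 2 + F ^ 2 * ξ 2 ^ 2

/-- `|x|_{1/F}² = x₁² + x₂² + x₃²/F²`. -/
def normInvFsq (F : ℝ) (x : EuclideanSpace ℝ (Fin 3)) : ℝ :=
  x 0 ^ 2 + x 1 ^ 2 + x 2 ^ 2 / F ^ 2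

/-- The operator `Λ = ∂₃²(−Δ_F)^{−1/2}` as the Fourier multiplier with symbol `−ξ₃²/|ξ|_F`. -/
def LambdaFourier (F : ℝ) (f : EuclideanSpace ℝ (Fin 3) → ℂ) :
    EuclideanSpace ℝ (Fin 3) → ℂ :=
  fun x => 𝓕⁻ (fun ξ => ((-(ξ 2 ^ 2) / Real.sqrt (normFsq F ξ) : ℝ) : ℂ) * 𝓕 f ξ) x

/-- The kernel `K(y) = −(2c/F³)(y₁² + y₂² − 3y₃²/F²)/|y|_{1/F}⁶`. -/
def Kker (c F : ℝ) (y : EuclideanSpace ℝ (Fin 3)) : ℝ :=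
  -(2 * c / F ^ 3) * (y 0 ^ 2 + y 1 ^ 2 - 3 * y 2 ^ 2 / F ^ 2) / (normInvFsq F y) ^ 3

/-- `Λ` defined on bounded `C²` functions by the absolutely convergent second-difference
singular integral `Λg(x) = (1/2) ∫ K(y)(g(x−y) + g(x+y) − 2g(x)) dy`. -/
def LambdaInt (c F : ℝ) (g : EuclideanSpace ℝ (Fin 3) → ℂ)
    (x : EuclideanSpace ℝ (Fin 3)) : ℂ :=
  (1 / 2 : ℂ) *
    ∫ y : EuclideanSpace ℝ (Fin 3),
      ((Kker c F y : ℝ) : ℂ) * (g (x - y) + g (x + y) - 2 * g x)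

theorem lintegral_rpow_conv_le {G : Type*} [NormedAddCommGroup G] [MeasurableSpace G]
    [BorelSpace G] [SecondCountableTopology G] (μ : Measure G) [SFinite μ]
    [μ.IsAddLeftInvariant] [μ.IsNegInvariant]
    {p : ℝ} (hp : 1 ≤ p)
    {k g : G → ℝ≥0∞} (hk : Measurable k) (hg : Measurable g) :
    ∫⁻ v, (∫⁻ u, k (v - u) * g u ∂μ) ^ p ∂μ ≤ (∫⁻ w, k w ∂μ) ^ p * ∫⁻ u, g u ^ p ∂μ := by
  have hkv (v : G) : ∫⁻ u, k (v - u) ∂μ = ∫⁻ w, k w ∂μ := lintegral_sub_left_eq_self k v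
  have hku (u : G) : ∫⁻ v, k (v - u) ∂μ = ∫⁻ w, k w ∂μ := lintegral_sub_right_eq_self k u
  have hm (v : G) : Measurable fun u => k (v - u) := hk.comp (measurable_const.sub measurable_id)
  have htonelli : ∫⁻ v, ∫⁻ u, k (v - u) * g u ^ p ∂μ ∂μ
      = (∫⁻ w, k w ∂μ) * ∫⁻ u, g u ^ p ∂μ := by
    rw [lintegral_lintegral_swap]
    · simp_rw [fun u => lintegral_mul_const (μ := μ) (g u ^ p)
        (show Measurable fun v => k (v - u) from hk.comp (measurable_id.sub measurable_const)), hku]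
      rw [lintegral_const_mul _ (hg.pow_const p)]
    · exact ((hk.comp (measurable_fst.sub measurable_snd)).mul
        ((hg.comp measurable_snd).pow_const p)).aemeasurable
  rcases hp.eq_or_lt with rfl | hp1
  · simpa using htonelli.le
  have hpq := Real.HolderConjugate.conjExponent hp1
  set q := p.conjExponent with hq
  have hp0 : 0 < p := by linarith
  have key (v : G) : (∫⁻ u, k (v - u) * g u ∂μ) ^ p
      ≤ (∫⁻ w, k w ∂μ) ^ (p - 1) * ∫⁻ u, k (v - u) * g u ^ p ∂μ := by
    have h := ENNReal.lintegral_mul_le_Lp_mul_Lq μ hpq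
      (f := fun u => k (v - u) ^ (1 / p) * g u) (g := fun u => k (v - u) ^ (1 / q))
      ((((hm v).pow_const _).mul hg).aemeasurable) ((hm v).pow_const _).aemeasurable
    have e1 (u : G) : ((fun u => k (v - u) ^ (1 / p) * g u) * fun u => k (v - u) ^ (1 / q)) u
        = k (v - u) * g u := by
      have : k (v - u) ^ (1 / p) * k (v - u) ^ (1 / q) = k (v - u) := by
        rw [← ENNReal.rpow_add_of_nonneg _ _ (by positivity) hpq.symm.one_div_nonneg,
          one_div, one_div, hpq.inv_add_inv_eq_one, ENNReal.rpow_one]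
      simp only [Pi.mul_apply]
      rw [mul_right_comm, this]
    have e2 (u : G) : (k (v - u) ^ (1 / p) * g u) ^ p = k (v - u) * g u ^ p := by
      rw [ENNReal.mul_rpow_of_nonneg _ _ hp0.le, ← ENNReal.rpow_mul, one_div,
        inv_mul_cancel₀ hp0.ne', ENNReal.rpow_one]
    have e3 (u : G) : (k (v - u) ^ (1 / q)) ^ q = k (v - u) := by
      rw [← ENNReal.rpow_mul, one_div, inv_mul_cancel₀ hpq.symm.pos.ne', ENNReal.rpow_one]
    simp_rw [e1, e2, e3, hkv] at h
    calc _ ≤ _ := ENNReal.rpow_le_rpow h hp0.le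
      _ = _ := by
        rw [ENNReal.mul_rpow_of_nonneg _ _ hp0.le, ← ENNReal.rpow_mul, ← ENNReal.rpow_mul,
          one_div_mul_cancel hp0.ne', ENNReal.rpow_one, mul_comm]
        congr 2
        rw [hq, Real.conjExponent]
        have : p - 1 ≠ 0 := by linarith
        field_simp
  calc _ ≤ ∫⁻ v, (∫⁻ w, k w ∂μ) ^ (p - 1) * ∫⁻ u, k (v - u) * g u ^ p ∂μ ∂μ := lintegral_mono key
    _ = (∫⁻ w, k w ∂μ) ^ (p - 1) * ∫⁻ v, ∫⁻ u, k (v - u) * g u ^ p ∂μ ∂μ := by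
      rw [lintegral_const_mul]
      exact Measurable.lintegral_prod_right' (f := fun z : G × G => k (z.1 - z.2) * g z.2 ^ p)
        ((hk.comp (measurable_fst.sub measurable_snd)).mul ((hg.comp measurable_snd).pow_const p))
    _ = _ := by
      rw [htonelli, ← mul_assoc]
      congr 1
      nth_rewrite 2 [← ENNReal.rpow_one (∫⁻ w, k w ∂μ)]
      rw [← ENNReal.rpow_add_of_nonneg _ _ (by linarith) zero_le_one, sub_add_cancel]

theorem eLpNorm_conv_le {G : Type*} [NormedAddCommGroup G] [MeasurableSpace G]
    [BorelSpace G] [SecondCountableTopology G] (μ : Measure G) [SFinite μ]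
    [μ.IsAddLeftInvariant] [μ.IsNegInvariant]
    {p : ℝ≥0∞} (hp : 1 ≤ p)
    {k g : G → ℝ≥0∞} (hk : Measurable k) (hg : Measurable g) :
    eLpNorm (fun v => ∫⁻ u, k (v - u) * g u ∂μ) p μ ≤ (∫⁻ w, k w ∂μ) * eLpNorm g p μ := by
  have hp0 : p ≠ 0 := (zero_lt_one.trans_le hp).ne'
  rcases eq_or_ne p ∞ with rfl | hpt
  · rw [eLpNorm_exponent_top, eLpNorm_exponent_top]
    refine eLpNormEssSup_le_of_ae_enorm_bound (Filter.Eventually.of_forall fun v => ?_)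
    calc ∫⁻ u, k (v - u) * g u ∂μ ≤ ∫⁻ u, k (v - u) * eLpNormEssSup g μ ∂μ := by
          refine lintegral_mono_ae ?_
          filter_upwards [enorm_ae_le_eLpNormEssSup g μ] with u hu
          gcongr
          simpa using hu
      _ = _ := by
        rw [lintegral_mul_const _
          (show Measurable fun u => k (v - u) from hk.comp (measurable_const.sub measurable_id)),
          lintegral_sub_left_eq_self k v]
  · have h1 : 1 ≤ p.toReal := by
      simpa using (ENNReal.toReal_le_toReal ENNReal.one_ne_top hpt).2 hp
    have h0 : 0 < p.toReal := by linarith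
    rw [eLpNorm_eq_lintegral_rpow_enorm_toReal hp0 hpt,
      eLpNorm_eq_lintegral_rpow_enorm_toReal hp0 hpt]
    simp only [enorm_eq_self]
    refine (ENNReal.rpow_le_rpow (lintegral_rpow_conv_le μ h1 hk hg) (by positivity)).trans_eq ?_
    rw [ENNReal.mul_rpow_of_nonneg _ _ (by positivity), ← ENNReal.rpow_mul,
      mul_one_div_cancel h0.ne', ENNReal.rpow_one]

theorem norm_second_difference_le {G : Type*} [NormedAddCommGroup G] [NormedSpace ℝ G]
    {D D' D'' : ℝ → G} {M : ℝ} (h1 : ∀ t, HasDerivAt D (D' t) t)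
    (h2 : ∀ t, HasDerivAt D' (D'' t) t) (hM : ∀ t, |t| ≤ 1 → ‖D'' t‖ ≤ M) :
    ‖D 1 + D (-1) - 2 • D 0‖ ≤ 2 * M := by
  have hD' : ∀ t ∈ Set.Icc (0 : ℝ) 1, ‖D' t - D' (-t)‖ ≤ 2 * M := by
    intro t ht
    have hM0 : 0 ≤ M := (norm_nonneg _).trans (hM 0 (by simp))
    have := (convex_Icc (-1 : ℝ) 1).norm_image_sub_le_of_norm_hasDerivWithin_le
      (f := D') (f' := D'') (C := M) (x := -t) (y := t)
      (fun s _ => (h2 s).hasDerivWithinAt) (fun s hs => hM s (abs_le.2 hs))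
      ⟨by linarith [ht.2], by linarith [ht.1]⟩ ⟨by linarith [ht.1], ht.2⟩
    refine this.trans ?_
    rw [sub_neg_eq_add, Real.norm_of_nonneg (by linarith [ht.1])]
    nlinarith [ht.2]
  have h3 (t : ℝ) : HasDerivAt (fun t => D t + D (-t)) (D' t - D' (-t)) t := by
    have := (h1 (-t)).scomp t (hasDerivAt_neg t)
    simpa [sub_eq_add_neg] using! (h1 t).add this
  have := (convex_Icc (0 : ℝ) 1).norm_image_sub_le_of_norm_hasDerivWithin_le
      (f := fun t => D t + D (-t)) (f' := fun t => D' t - D' (-t)) (C := 2 * M) (x := 0) (y := 1)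
      (fun s _ => (h3 s).hasDerivWithinAt) hD' (by simp) (by simp)
  simpa [two_smul] using! this

theorem SchwartzMap.exists_local_decay {E G : Type*} [NormedAddCommGroup E] [NormedSpace ℝ E]
    [NormedAddCommGroup G] [NormedSpace ℝ G] (h : 𝓢(E, G)) (k : ℕ) :
    ∃ M : ℝ, 0 ≤ M ∧ ∀ a z : E, ‖z - a‖ ≤ 2 → ‖h z‖ ≤ M / (1 + ‖a‖) ^ k := by
  set S := 2 ^ k * ((Finset.Iic (k, 0)).sup fun m => SchwartzMap.seminorm ℝ m.1 m.2) h with hS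
  have hb (z : E) : (1 + ‖z‖) ^ k * ‖h z‖ ≤ S := by
    simpa using! SchwartzMap.one_add_le_sup_seminorm_apply (𝕜 := ℝ) (m := (k, 0))
      (le_refl k) (le_refl 0) h z
  have hS0 : 0 ≤ S := le_trans (by positivity) (hb 0)
  refine ⟨3 ^ k * S, by positivity, fun a z haz => ?_⟩
  rw [le_div_iff₀ (by positivity)]
  have h3 : 1 + ‖a‖ ≤ 3 * (1 + ‖z‖) := by
    have : ‖a‖ ≤ ‖z‖ + ‖z - a‖ := by
      rw [norm_sub_rev]
      exact (norm_le_norm_add_norm_sub' a z)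
    linarith [norm_nonneg z]
  calc ‖h z‖ * (1 + ‖a‖) ^ k ≤ ‖h z‖ * (3 * (1 + ‖z‖)) ^ k := by gcongr
    _ = 3 ^ k * ((1 + ‖z‖) ^ k * ‖h z‖) := by rw [mul_pow]; ring
    _ ≤ _ := by gcongr; exact hb z

theorem SchwartzMap.exists_local_lipschitz {E G : Type*} [NormedAddCommGroup E] [NormedSpace ℝ E]
    [NormedAddCommGroup G] [NormedSpace ℝ G] (h : 𝓢(E, G)) (k : ℕ) :
    ∃ M : ℝ, 0 ≤ M ∧ ∀ a z w : E, ‖z - a‖ ≤ 2 → ‖w - a‖ ≤ 2 →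
      ‖h z - h w‖ ≤ M / (1 + ‖a‖) ^ k * ‖z - w‖ := by
  obtain ⟨M, hM, b⟩ := (SchwartzMap.fderivCLM ℝ E G h).exists_local_decay k
  refine ⟨M, hM, fun a z w hz hw => ?_⟩
  exact (convex_closedBall a 2).norm_image_sub_le_of_norm_hasFDerivWithin_le
    (fun s _ => (h.differentiableAt (x := s)).hasFDerivAt.hasFDerivWithinAt)
    (fun s hs => b a s (by simpa [dist_eq_norm] using! hs))
    (by simpa [dist_eq_norm] using! hw) (by simpa [dist_eq_norm] using! hz)

theorem HasFDerivAt.hasDerivAt_clm_apply_curve {E G : Type*} [NormedAddCommGroup E]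
    [NormedSpace ℝ E] [NormedAddCommGroup G] [NormedSpace ℝ G] {h : E → E →L[ℝ] G}
    {L : E →L[ℝ] E →L[ℝ] G} {γ δ : ℝ → E} {v w : E} {t : ℝ} (hh : HasFDerivAt h L (γ t))
    (hγ : HasDerivAt γ v t) (hδ : HasDerivAt δ w t) :
    HasDerivAt (fun s => h (γ s) (δ s)) (L v (δ t) + h (γ t) w) t := by
  have h1 : HasDerivAt (fun s => h (γ s)) (L v) t := hh.comp_hasDerivAt t hγ
  exact h1.clm_apply hδ

theorem norm_curve_comparison_le {E : Type*} [NormedAddCommGroup E] [NormedSpace ℝ E]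
    {h : E → ℂ} {h1 : E → E →L[ℝ] ℂ} {h2 : E → E →L[ℝ] E →L[ℝ] ℂ}
    (d1 : ∀ x, HasFDerivAt h (h1 x) x) (d2 : ∀ x, HasFDerivAt h1 (h2 x) x)
    {a η : E} {B C₀ ε : ℝ} (hB : 0 ≤ B)
    (b1 : ∀ z, ‖z - a‖ ≤ 2 → ‖h1 z‖ ≤ B) (b2 : ∀ z, ‖z - a‖ ≤ 2 → ‖h2 z‖ ≤ B)
    (b3 : ∀ z w, ‖z - a‖ ≤ 2 → ‖w - a‖ ≤ 2 → ‖h2 z - h2 w‖ ≤ B * ‖z - w‖)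
    (hε : 0 ≤ ε) (hε4 : ε ≤ 1 / 4) (hη : ‖η‖ ≤ 1) {β β' β'' : ℝ → E}
    (hβ : ∀ t, HasDerivAt β (β' t) t) (hβ' : ∀ t, HasDerivAt β' (β'' t) t)
    (hβ0 : β 0 = 0) (hβη : ∀ t, ‖β' t - η‖ ≤ ε * ‖η‖)
    (hβ'' : ∀ t, ‖β'' t‖ ≤ C₀ * ε * ‖η‖ ^ 2) :
    ‖(h (a + η) + h (a - η)) - (h (a + β 1) + h (a + β (-1)))‖
      ≤ 2 * (B * (13 / 4 + C₀) * ε * ‖η‖ ^ 2) := by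
  have hsub (t : ℝ) (ht : |t| ≤ 1) : ‖β t - t • η‖ ≤ ε * ‖η‖ := by
    have hd (t : ℝ) : HasDerivAt (fun t => β t - t • η) (β' t - η) t := by
      simpa using! (hβ t).sub ((hasDerivAt_id t).smul_const η)
    have := (convex_univ (𝕜 := ℝ)).norm_image_sub_le_of_norm_hasDerivWithin_le
      (f := fun t => β t - t • η) (f' := fun t => β' t - η) (C := ε * ‖η‖) (x := 0) (y := t)
      (fun s _ => (hd s).hasDerivWithinAt) (fun s _ => hβη s) trivial trivial
    simp only [hβ0, zero_smul, sub_zero, Real.norm_eq_abs] at this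
    exact this.trans (mul_le_of_le_one_right (by positivity) ht)
  have hline (t : ℝ) (ht : |t| ≤ 1) : ‖t • η‖ ≤ 1 := by
    rw [norm_smul, Real.norm_eq_abs]
    exact mul_le_one₀ ht (norm_nonneg _) hη
  have hcurve (t : ℝ) (ht : |t| ≤ 1) : ‖β t‖ ≤ 2 := by
    have h5 := norm_add_le (β t - t • η) (t • η)
    rw [sub_add_cancel] at h5
    have := hsub t ht
    have := hline t ht
    nlinarith [norm_nonneg η]
  have e1 (t : ℝ) : HasDerivAt (fun t => h (a + t • η) - h (a + β t))
      (h1 (a + t • η) η - h1 (a + β t) (β' t)) t := by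
    refine ((d1 _).comp_hasDerivAt t ?_).sub ((d1 _).comp_hasDerivAt t ?_)
    · simpa using ((hasDerivAt_id t).smul_const η).const_add a
    · exact (hβ t).const_add a
  have e2 (t : ℝ) : HasDerivAt (fun t => h1 (a + t • η) η - h1 (a + β t) (β' t))
      (h2 (a + t • η) η η - (h2 (a + β t) (β' t) (β' t) + h1 (a + β t) (β'' t))) t := by
    refine HasDerivAt.sub ?_ ?_
    · have hl : HasDerivAt (fun t : ℝ => a + t • η) η t := by
        simpa using ((hasDerivAt_id t).smul_const η).const_add a
      have := (d2 (a + t • η)).hasDerivAt_clm_apply_curve hl (hasDerivAt_const t η)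
      rwa [map_zero, add_zero] at this
    · exact (d2 (a + β t)).hasDerivAt_clm_apply_curve ((hβ t).const_add a) (hβ' t)
  have bound (t : ℝ) (ht : |t| ≤ 1) :
      ‖h2 (a + t • η) η η - (h2 (a + β t) (β' t) (β' t) + h1 (a + β t) (β'' t))‖
        ≤ B * (13 / 4 + C₀) * ε * ‖η‖ ^ 2 := by
    have t1 : ‖h2 (a + t • η) - h2 (a + β t)‖ ≤ B * (ε * ‖η‖) := by
      refine (b3 _ _ ?_ ?_).trans ?_
      · rw [add_sub_cancel_left]; linarith [hline t ht]
      · rw [add_sub_cancel_left]; exact hcurve t ht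
      gcongr
      rw [add_sub_add_left_eq_sub, norm_sub_rev]
      exact hsub t ht
    have q2 : ‖h2 (a + β t)‖ ≤ B := b2 _ (by simpa using hcurve t ht)
    have q1 : ‖h1 (a + β t)‖ ≤ B := b1 _ (by simpa using hcurve t ht)
    have q3 : ‖β' t‖ ≤ 5 / 4 * ‖η‖ := by
      have h5 := norm_add_le (β' t - η) η
      rw [sub_add_cancel] at h5
      nlinarith [hβη t, norm_nonneg η]
    have split : h2 (a + t • η) η η - (h2 (a + β t) (β' t) (β' t) + h1 (a + β t) (β'' t))
        = (h2 (a + t • η) - h2 (a + β t)) η η - h2 (a + β t) (β' t - η) η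
          - h2 (a + β t) (β' t) (β' t - η) - h1 (a + β t) (β'' t) := by
      simp only [sub_apply, map_sub]
      ring
    rw [split]
    have n1 : ‖(h2 (a + t • η) - h2 (a + β t)) η η‖ ≤ B * (ε * ‖η‖) * ‖η‖ * ‖η‖ :=
      (ContinuousLinearMap.le_opNorm₂ _ _ _).trans (by gcongr)
    have n2 : ‖h2 (a + β t) (β' t - η) η‖ ≤ B * (ε * ‖η‖) * ‖η‖ :=
      (ContinuousLinearMap.le_opNorm₂ _ _ _).trans (by gcongr; exact hβη t)
    have n3 : ‖h2 (a + β t) (β' t) (β' t - η)‖ ≤ B * (5 / 4 * ‖η‖) * (ε * ‖η‖) :=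
      (ContinuousLinearMap.le_opNorm₂ _ _ _).trans (by gcongr; exact hβη t)
    have n4 : ‖h1 (a + β t) (β'' t)‖ ≤ B * (C₀ * ε * ‖η‖ ^ 2) :=
      (ContinuousLinearMap.le_opNorm _ _).trans (by gcongr; exact hβ'' t)
    have n1' : B * (ε * ‖η‖) * ‖η‖ * ‖η‖ ≤ B * (ε * ‖η‖) * ‖η‖ * 1 := by gcongr
    refine (norm_sub_le _ _).trans ((add_le_add_left (norm_sub_le _ _) _).trans
      ((add_le_add_left (add_le_add_left (norm_sub_le _ _) _) _).trans ?_))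
    calc _ ≤ B * (ε * ‖η‖) * ‖η‖ * 1 + B * (ε * ‖η‖) * ‖η‖
          + B * (5 / 4 * ‖η‖) * (ε * ‖η‖) + B * (C₀ * ε * ‖η‖ ^ 2) := by
          linarith
      _ = _ := by ring
  have := norm_second_difference_le e1 e2 bound
  simp only [one_smul, neg_smul, zero_smul, hβ0, sub_self, smul_zero, sub_zero] at this
  calc _ = ‖h (a + η) - h (a + β 1) + (h (a + -η) - h (a + β (-1)))‖ := by
        congr 1; rw [sub_eq_add_neg a η]; ring
    _ ≤ _ := this

theorem SchwartzMap.exists_curve_comparison {E : Type*} [NormedAddCommGroup E] [NormedSpace ℝ E]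
    (h : 𝓢(E, ℂ)) (C₀ : ℝ) (hC₀ : 0 ≤ C₀) :
    ∃ C : ℝ, 0 ≤ C ∧ ∀ (ε : ℝ), 0 ≤ ε → ε ≤ 1 / 4 → ∀ (a η : E), ‖η‖ ≤ 1 →
      ∀ β β' β'' : ℝ → E, (∀ t, HasDerivAt β (β' t) t) → (∀ t, HasDerivAt β' (β'' t) t) →
      β 0 = 0 → (∀ t, ‖β' t - η‖ ≤ ε * ‖η‖) → (∀ t, ‖β'' t‖ ≤ C₀ * ε * ‖η‖ ^ 2) →
      ‖(h (a + η) + h (a - η)) - (h (a + β 1) + h (a + β (-1)))‖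
        ≤ C * ε * ‖η‖ ^ 2 / (1 + ‖a‖) ^ 4 := by
  set h1 := SchwartzMap.fderivCLM ℝ E ℂ h with hh1
  set h2 := SchwartzMap.fderivCLM ℝ E (E →L[ℝ] ℂ) h1 with hh2
  obtain ⟨M1, hM1, b1⟩ := h1.exists_local_decay 4
  obtain ⟨M2, hM2, b2⟩ := h2.exists_local_decay 4
  obtain ⟨M3, hM3, b3⟩ := h2.exists_local_lipschitz 4
  refine ⟨2 * ((M1 + M2 + M3) * (13 / 4 + C₀)), by positivity, ?_⟩
  intro ε hε hε4 a η hη β β' β'' hβ hβ' hβ0 hβη hβ''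
  have hw : 0 < (1 + ‖a‖) ^ 4 := by positivity
  refine (norm_curve_comparison_le (h := h) (h1 := h1) (h2 := h2)
    (B := (M1 + M2 + M3) / (1 + ‖a‖) ^ 4) (a := a) (η := η)
    (fun x => h.differentiableAt.hasFDerivAt) (fun x => h1.differentiableAt.hasFDerivAt)
    (by positivity)
    (fun z hz => (b1 a z hz).trans ?_) (fun z hz => (b2 a z hz).trans ?_)
    (fun z w hz hw => (b3 a z w hz hw).trans ?_) hε hε4 hη hβ hβ' hβ0 hβη hβ'').trans_eq ?_
  · gcongr; linarith
  · gcongr; linarith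
  · gcongr; linarith
  · ring

local notation "ℝ³" => EuclideanSpace ℝ (Fin 3)

/-- A bounded modification of `Kker` that agrees with it where `r² ≤ |y|²_{1/F}`. -/
def KkerReg (c F r : ℝ) (y : ℝ³) : ℝ :=
  -(2 * c / F ^ 3) * (y 0 ^ 2 + y 1 ^ 2 - 3 * y 2 ^ 2 / F ^ 2) / (max (normInvFsq F y) (r ^ 2)) ^ 3

theorem norm_sq_eq_sum_three (y : ℝ³) : ‖y‖ ^ 2 = y 0 ^ 2 + y 1 ^ 2 + y 2 ^ 2 := by
  rw [EuclideanSpace.norm_sq_eq, Fin.sum_univ_three]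
  simp

theorem norm_sq_le_normInvFsq {F : ℝ} (hF : F ∈ Set.Ioc (0 : ℝ) 1) (y : ℝ³) :
    ‖y‖ ^ 2 ≤ normInvFsq F y := by
  have hF2 : F ^ 2 ≤ 1 := pow_le_one₀ hF.1.le hF.2
  have := le_div_self (sq_nonneg (y 2)) (pow_pos hF.1 2) hF2
  rw [norm_sq_eq_sum_three, normInvFsq]
  linarith

theorem normInvFsq_le {F : ℝ} (hF : F ∈ Set.Ioc (0 : ℝ) 1) (y : ℝ³) :
    normInvFsq F y ≤ 1 / F ^ 2 * ‖y‖ ^ 2 := by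
  have hF2 : 1 ≤ 1 / F ^ 2 := by
    rw [le_div_iff₀ (pow_pos hF.1 2), one_mul]
    exact pow_le_one₀ hF.1.le hF.2
  rw [norm_sq_eq_sum_three, normInvFsq, div_eq_mul_one_div (y 2 ^ 2)]
  nlinarith [sq_nonneg (y 0), sq_nonneg (y 1)]

theorem abs_numerator_le (F : ℝ) (y : ℝ³) :
    |y 0 ^ 2 + y 1 ^ 2 - 3 * y 2 ^ 2 / F ^ 2| ≤ 3 * normInvFsq F y := by
  have h : 0 ≤ y 2 ^ 2 / F ^ 2 := by positivity
  rw [normInvFsq, abs_le, mul_div_assoc]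
  constructor <;> nlinarith [sq_nonneg (y 0), sq_nonneg (y 1)]

theorem abs_sq_coord_sub_le (a b : ℝ³) (i : Fin 3) :
    |a i ^ 2 - b i ^ 2| ≤ ‖a - b‖ * (‖a‖ + ‖b‖) := by
  have h1 : |a i - b i| ≤ ‖a - b‖ := by simpa using PiLp.norm_apply_le (a - b) i
  have h2 : |a i + b i| ≤ ‖a‖ + ‖b‖ :=
    (abs_add_le _ _).trans (add_le_add (PiLp.norm_apply_le a i) (PiLp.norm_apply_le b i))
  rw [show a i ^ 2 - b i ^ 2 = (a i - b i) * (a i + b i) by ring, abs_mul]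
  gcongr

theorem abs_weighted_sq_sub_le {F : ℝ} (hF : F ∈ Set.Ioc (0 : ℝ) 1) (a b : ℝ³) {t : ℝ}
    (ht : |t| ≤ 3) :
    |(a 0 ^ 2 + a 1 ^ 2 + t * a 2 ^ 2 / F ^ 2) - (b 0 ^ 2 + b 1 ^ 2 + t * b 2 ^ 2 / F ^ 2)|
      ≤ 5 / F ^ 2 * (‖a - b‖ * (‖a‖ + ‖b‖)) := by
  have hF2 : 1 ≤ 1 / F ^ 2 := by
    rw [le_div_iff₀ (pow_pos hF.1 2), one_mul]
    exact pow_le_one₀ hF.1.le hF.2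
  set X := ‖a - b‖ * (‖a‖ + ‖b‖) with hX
  have hX0 : 0 ≤ X := by positivity
  have h0 := abs_sq_coord_sub_le a b 0
  have h1 := abs_sq_coord_sub_le a b 1
  have h2 := abs_sq_coord_sub_le a b 2
  have e : (a 0 ^ 2 + a 1 ^ 2 + t * a 2 ^ 2 / F ^ 2) - (b 0 ^ 2 + b 1 ^ 2 + t * b 2 ^ 2 / F ^ 2)
      = (a 0 ^ 2 - b 0 ^ 2) + (a 1 ^ 2 - b 1 ^ 2) + t * (1 / F ^ 2) * (a 2 ^ 2 - b 2 ^ 2) := by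
    ring
  have h3 : |t * (1 / F ^ 2) * (a 2 ^ 2 - b 2 ^ 2)| ≤ 3 * (1 / F ^ 2) * X := by
    rw [abs_mul, abs_mul, abs_of_nonneg (by positivity : 0 ≤ 1 / F ^ 2)]
    gcongr
  rw [e, show 5 / F ^ 2 = 5 * (1 / F ^ 2) by ring]
  refine (abs_add_three _ _ _).trans ?_
  nlinarith

theorem abs_div_cube_sub_le {Na Nb sa sb δ L : ℝ} (hsa : 0 < sa) (hsb : 0 < sb) (hL : 1 ≤ L)
    (hN : |Na - Nb| ≤ δ * sa) (hNb : |Nb| ≤ 3 * sb) (hs : |sb - sa| ≤ δ * sa)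
    (hsab : sa ≤ 2 * L * sb) :
    |Na / sa ^ 3 - Nb / sb ^ 3| ≤ 22 * δ * L ^ 2 / sa ^ 2 := by
  have hδ : 0 ≤ δ := by
    have := (abs_nonneg _).trans hN
    exact nonneg_of_mul_nonneg_left this hsa
  have e : Na / sa ^ 3 - Nb / sb ^ 3
      = (Na - Nb) / sa ^ 3
        + Nb * ((sb - sa) * (sb ^ 2 + sb * sa + sa ^ 2)) / (sa ^ 3 * sb ^ 3) := by
    field_simp
    ring
  have i1 : |(Na - Nb) / sa ^ 3| ≤ δ / sa ^ 2 := by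
    rw [abs_div, abs_of_pos (pow_pos hsa 3), div_le_div_iff₀ (by positivity) (by positivity)]
    calc |Na - Nb| * sa ^ 2 ≤ δ * sa * sa ^ 2 := by gcongr
      _ = _ := by ring
  have i2 : |Nb * ((sb - sa) * (sb ^ 2 + sb * sa + sa ^ 2)) / (sa ^ 3 * sb ^ 3)|
      ≤ 21 * δ * L ^ 2 / sa ^ 2 := by
    rw [abs_div, abs_of_pos (by positivity : 0 < sa ^ 3 * sb ^ 3),
      div_le_div_iff₀ (by positivity) (by positivity), abs_mul, abs_mul,
      abs_of_pos (by positivity : 0 < sb ^ 2 + sb * sa + sa ^ 2)]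
    have q : sb ^ 2 + sb * sa + sa ^ 2 ≤ 7 * L ^ 2 * sb ^ 2 := by
      have : sb ^ 2 + sb * sa + sa ^ 2
          ≤ sb ^ 2 + sb * (2 * L * sb) + (2 * L * sb) ^ 2 := by gcongr
      have h1 : sb ^ 2 ≤ L ^ 2 * sb ^ 2 := le_mul_of_one_le_left (by positivity) (one_le_pow₀ hL)
      have h2 : L * sb ^ 2 ≤ L ^ 2 * sb ^ 2 := by
        gcongr
        nlinarith
      nlinarith
    calc |Nb| * (|sb - sa| * (sb ^ 2 + sb * sa + sa ^ 2)) * sa ^ 2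
        ≤ (3 * sb) * ((δ * sa) * (7 * L ^ 2 * sb ^ 2)) * sa ^ 2 := by gcongr
      _ = _ := by ring
  rw [e]
  refine (abs_add_le _ _).trans ((add_le_add i1 i2).trans ?_)
  rw [← add_div]
  gcongr
  nlinarith [one_le_pow₀ hL (n := 2)]

theorem one_div_max_sq_le {F r : ℝ} (hF : F ∈ Set.Ioc (0 : ℝ) 1) (hr : 0 < r) (y : ℝ³) :
    1 / max (normInvFsq F y) (r ^ 2) ^ 2 ≤ 16 / (r + ‖y‖) ^ 4 := by
  have hs : 0 < max (normInvFsq F y) (r ^ 2) := lt_max_of_lt_right (by positivity)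
  have h1 : ((r + ‖y‖) / 2) ^ 2 ≤ max (normInvFsq F y) (r ^ 2) := by
    have h3 := (norm_sq_le_normInvFsq hF y).trans (le_max_left _ (r ^ 2))
    have h4 := le_max_right (normInvFsq F y) (r ^ 2)
    nlinarith [sq_nonneg (r - ‖y‖)]
  rw [div_le_div_iff₀ (by positivity) (by positivity)]
  calc 1 * (r + ‖y‖) ^ 4 = 16 * (((r + ‖y‖) / 2) ^ 2) ^ 2 := by ring
    _ ≤ _ := by gcongr

theorem abs_KkerReg_le {c F r : ℝ} (hc : 0 < c) (hF : F ∈ Set.Ioc (0 : ℝ) 1) (hr : 0 < r)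
    (y : ℝ³) : |KkerReg c F r y| ≤ 96 * c / F ^ 3 / (r + ‖y‖) ^ 4 := by
  have hF0 := hF.1
  set s := max (normInvFsq F y) (r ^ 2) with hsdef
  have hs : 0 < s := lt_max_of_lt_right (by positivity)
  rw [KkerReg, ← hsdef, mul_div_assoc, abs_mul, abs_neg, abs_of_pos (by positivity), abs_div,
    abs_of_pos (pow_pos hs 3)]
  calc 2 * c / F ^ 3 * (|y 0 ^ 2 + y 1 ^ 2 - 3 * y 2 ^ 2 / F ^ 2| / s ^ 3)
      ≤ 2 * c / F ^ 3 * (3 * s / s ^ 3) := by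
        gcongr
        exact (abs_numerator_le F y).trans (by gcongr; exact le_max_left _ _)
    _ = 6 * c / F ^ 3 * (1 / s ^ 2) := by field_simp; ring
    _ ≤ 6 * c / F ^ 3 * (16 / (r + ‖y‖) ^ 4) :=
        mul_le_mul_of_nonneg_left (one_div_max_sq_le hF hr y) (by positivity)
    _ = _ := by ring

theorem abs_KkerReg_sub_le {c F r ε : ℝ} (hc : 0 < c) (hF : F ∈ Set.Ioc (0 : ℝ) 1) (hr : 0 < r)
    (hε0 : 0 ≤ ε) (hε : ε ≤ 1 / 4) {a b : ℝ³} (hab : ‖a - b‖ ≤ ε * ‖a‖) :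
    |KkerReg c F r a - KkerReg c F r b| ≤ 8448 * c / F ^ 9 * ε / (r + ‖a‖) ^ 4 := by
  have hF0 := hF.1
  have hL : 1 ≤ 1 / F ^ 2 := by
    rw [le_div_iff₀ (pow_pos hF.1 2), one_mul]
    exact pow_le_one₀ hF.1.le hF.2
  have hε4 : ε * ‖a‖ ≤ 1 / 4 * ‖a‖ := by gcongr
  have hb1 : ‖b‖ ≤ 5 / 4 * ‖a‖ := by
    have := norm_le_norm_add_norm_sub a b
    linarith
  have hb2 : ‖a‖ ≤ 4 / 3 * ‖b‖ := by
    have := norm_le_norm_add_norm_sub' a b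
    linarith
  set sa := max (normInvFsq F a) (r ^ 2) with hsa
  set sb := max (normInvFsq F b) (r ^ 2) with hsb
  have sa0 : 0 < sa := lt_max_of_lt_right (by positivity)
  have sb0 : 0 < sb := lt_max_of_lt_right (by positivity)
  have hasa : ‖a‖ ^ 2 ≤ sa := (norm_sq_le_normInvFsq hF a).trans (le_max_left _ _)
  have hT : 5 / F ^ 2 * (‖a - b‖ * (‖a‖ + ‖b‖)) ≤ 12 / F ^ 2 * ε * sa := by
    calc 5 / F ^ 2 * (‖a - b‖ * (‖a‖ + ‖b‖)) ≤ 5 / F ^ 2 * ((ε * ‖a‖) * (‖a‖ + 5 / 4 * ‖a‖)) := by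
          gcongr
      _ = 45 / 4 * (1 / F ^ 2) * (ε * ‖a‖ ^ 2) := by ring
      _ ≤ 12 * (1 / F ^ 2) * (ε * sa) := by gcongr; norm_num
      _ = _ := by ring
  have hN := (abs_weighted_sq_sub_le hF a b (t := -3) (by norm_num)).trans hT
  have hq := (abs_weighted_sq_sub_le hF a b (t := 1) (by norm_num)).trans hT
  have hs : |sb - sa| ≤ 12 / F ^ 2 * ε * sa := by
    rw [abs_sub_comm]
    refine (abs_max_sub_max_le_abs _ _ _).trans ?_
    simpa [normInvFsq] using hq
  have hsab : sa ≤ 2 * (1 / F ^ 2) * sb := by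
    have hbsb : ‖b‖ ^ 2 ≤ sb := (norm_sq_le_normInvFsq hF b).trans (le_max_left _ _)
    refine max_le ((normInvFsq_le hF a).trans ?_) ?_
    · calc 1 / F ^ 2 * ‖a‖ ^ 2 ≤ 1 / F ^ 2 * (4 / 3 * ‖b‖) ^ 2 := by gcongr
        _ = 16 / 9 * (1 / F ^ 2) * ‖b‖ ^ 2 := by ring
        _ ≤ _ := by gcongr; norm_num
    · have : r ^ 2 ≤ sb := le_max_right _ _
      nlinarith
  have hNb : |b 0 ^ 2 + b 1 ^ 2 - 3 * b 2 ^ 2 / F ^ 2| ≤ 3 * sb :=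
    (abs_numerator_le F b).trans (by gcongr; exact le_max_left _ _)
  have main := abs_div_cube_sub_le sa0 sb0 hL (Na := a 0 ^ 2 + a 1 ^ 2 - 3 * a 2 ^ 2 / F ^ 2)
    (by simpa [neg_div, ← sub_eq_add_neg] using hN) hNb hs hsab
  rw [KkerReg, KkerReg, ← hsa, ← hsb, mul_div_assoc (-(2 * c / F ^ 3)),
    mul_div_assoc (-(2 * c / F ^ 3)), ← mul_sub, abs_mul, abs_neg,
    abs_of_pos (by positivity : 0 < 2 * c / F ^ 3)]
  calc _ ≤ 2 * c / F ^ 3 * (22 * (12 / F ^ 2 * ε) * (1 / F ^ 2) ^ 2 / sa ^ 2) := by gcongr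
    _ = 528 * c / F ^ 9 * ε * (1 / sa ^ 2) := by field_simp; ring
    _ ≤ 528 * c / F ^ 9 * ε * (16 / (r + ‖a‖) ^ 4) :=
        mul_le_mul_of_nonneg_left (one_div_max_sq_le hF hr a) (by positivity)
    _ = _ := by ring

theorem abs_Kker_sub_KkerReg_le {c F r : ℝ} (hc : 0 < c) (hF : F ∈ Set.Ioc (0 : ℝ) 1) (hr : 0 < r)
    (y : ℝ³) :
    |Kker c F y - KkerReg c F r y|
      ≤ (Metric.ball (0 : ℝ³) r).indicator (fun y => 12 * c / F ^ 3 / ‖y‖ ^ 4) y := by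
  have hF0 := hF.1
  have hq := norm_sq_le_normInvFsq hF y
  rcases le_or_gt (r ^ 2) (normInvFsq F y) with h | h
  · have : Kker c F y - KkerReg c F r y = 0 := by
      rw [Kker, KkerReg, max_eq_left h, sub_self]
    rw [this, abs_zero]
    exact Set.indicator_nonneg (fun _ _ => by positivity) _
  have hy : y ∈ Metric.ball (0 : ℝ³) r := by
    rw [mem_ball_zero_iff]
    exact lt_of_pow_lt_pow_left₀ 2 hr.le (hq.trans_lt h)
  rw [Set.indicator_of_mem hy]
  rcases eq_or_ne y 0 with rfl | hy0
  · simp [Kker, KkerReg]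
  have hy1 : 0 < ‖y‖ := norm_pos_iff.2 hy0
  set q := normInvFsq F y with hqdef
  have hq0 : 0 < q := lt_of_lt_of_le (by positivity) hq
  have hN : |y 0 ^ 2 + y 1 ^ 2 - 3 * y 2 ^ 2 / F ^ 2| ≤ 3 * q := abs_numerator_le F y
  have bound (s : ℝ) (hs : q ≤ s) :
      |-(2 * c / F ^ 3) * (y 0 ^ 2 + y 1 ^ 2 - 3 * y 2 ^ 2 / F ^ 2) / s ^ 3|
        ≤ 6 * c / F ^ 3 / ‖y‖ ^ 4 := by
    have hs0 : 0 < s := hq0.trans_le hs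
    rw [mul_div_assoc, abs_mul, abs_neg, abs_of_pos (by positivity : 0 < 2 * c / F ^ 3), abs_div,
      abs_of_pos (pow_pos hs0 3)]
    calc _ ≤ 2 * c / F ^ 3 * (3 * q / q ^ 3) := by gcongr
      _ = 6 * c / F ^ 3 / q ^ 2 := by field_simp; ring
      _ ≤ 6 * c / F ^ 3 / (‖y‖ ^ 2) ^ 2 := by gcongr
      _ = _ := by ring
  calc _ ≤ 6 * c / F ^ 3 / ‖y‖ ^ 4 + 6 * c / F ^ 3 / ‖y‖ ^ 4 :=
        (abs_sub _ _).trans (add_le_add (bound q le_rfl) (bound _ (le_max_left _ _)))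
    _ = _ := by ring

theorem continuous_normInvFsq (F : ℝ) : Continuous (normInvFsq F) := by
  unfold normInvFsq
  fun_prop

theorem continuous_KkerReg (c F : ℝ) {r : ℝ} (hr : 0 < r) : Continuous (KkerReg c F r) := by
  have h := continuous_normInvFsq F
  unfold KkerReg
  refine Continuous.div (by fun_prop) (by fun_prop) fun y => ?_
  exact (pow_pos (lt_max_of_lt_right (by positivity)) 3).ne'

theorem measurable_Kker (c F : ℝ) : Measurable (Kker c F) := by
  have h := (continuous_normInvFsq F).measurable
  unfold Kker
  fun_prop

theorem KkerReg_neg (c F r : ℝ) (y : ℝ³) : KkerReg c F r (-y) = KkerReg c F r y := by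
  simp [KkerReg, normInvFsq]

theorem SchwartzMap.exists_reproducing_kernel (R : ℝ) (hR : 0 < R) :
    ∃ h : 𝓢(ℝ³, ℂ), ∀ r : ℝ, 0 < r → ∀ f : 𝓢(ℝ³, ℂ),
      (∀ ξ, 𝓕 (⇑f) ξ ≠ 0 → r * ‖ξ‖ ≤ R) →
      ∀ z, f z = ∫ u, f u * (((r⁻¹ ^ 3 : ℝ) : ℂ) * h (r⁻¹ • (z - u))) := by
  let χ : ContDiffBump (0 : ℝ³) := ⟨R, R + 1, hR, by linarith⟩
  have hχc : HasCompactSupport fun x => (χ x : ℂ) := by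
    exact χ.hasCompactSupport.comp_left (g := ((↑) : ℝ → ℂ)) rfl
  have hχs : ContDiff ℝ (⊤ : ℕ∞) fun x => (χ x : ℂ) :=
    Complex.ofRealCLM.contDiff.comp χ.contDiff
  let χS : 𝓢(ℝ³, ℂ) := hχc.toSchwartzMap hχs
  refine ⟨𝓕⁻ χS, fun r hr f hf z => ?_⟩
  let g : ℝ³ → ℂ := fun ξ => Real.fourierChar (inner ℝ ξ z) • χS (r • ξ)
  have hgi : Integrable g := by
    have h1 : Integrable fun ξ => χS (r • ξ) := χS.integrable.comp_smul hr.ne'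
    have := (VectorFourier.fourierIntegral_convergent_iff (μ := volume) (L := innerₗ ℝ³)
      Real.continuous_fourierChar continuous_inner (-z)).2 h1
    simpa [g] using! this
  have hinv : f z = ∫ ξ, 𝓕 (⇑f) ξ • g ξ := by
    have h1 : f z = 𝓕⁻ (𝓕 (⇑f)) z := by
      have := congrArg (fun k : 𝓢(ℝ³, ℂ) => k z) 
        (show 𝓕⁻ (𝓕 f : 𝓢(ℝ³, ℂ)) = f from FourierTransform.fourierInv_fourier_eq f)
      simp only [SchwartzMap.fourierInv_coe, SchwartzMap.fourier_coe] at this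
      exact this.symm
    rw [h1, Real.fourierInv_eq]
    refine integral_congr_ae (Filter.Eventually.of_forall fun ξ => ?_)
    by_cases hξ : 𝓕 (⇑f) ξ = 0
    · simp [hξ]
    · have h2 : χS (r • ξ) = 1 := by
        have : χ (r • ξ) = 1 := χ.one_of_mem_closedBall (by
          simpa [norm_smul, abs_of_pos hr] using hf ξ hξ)
        simp [χS, this]
      simp only [g, h2, smul_eq_mul, Circle.smul_def]
      ring
  have hflip : ∫ ξ, 𝓕 (⇑f) ξ • g ξ = ∫ u, f u • 𝓕 g u := by
    simpa using! VectorFourier.integral_fourierIntegral_smul_eq_flip (L := innerₗ ℝ³)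
      Real.continuous_fourierChar continuous_inner (f.integrable (μ := volume)) hgi
  rw [hinv, hflip]
  refine integral_congr_ae (Filter.Eventually.of_forall fun u => ?_)
  simp only [smul_eq_mul]
  congr 1
  rw [SchwartzMap.fourierInv_coe, Real.fourier_eq, Real.fourierInv_eq]
  have hs := Measure.integral_comp_smul (volume : Measure ℝ³)
    (fun ξ => Real.fourierChar (inner ℝ ξ (r⁻¹ • (z - u))) • χS ξ) r
  rw [finrank_euclideanSpace_fin, abs_of_pos (by positivity)] at hs
  have e : ∀ ξ, Real.fourierChar (-inner ℝ ξ u) • g ξ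
      = Real.fourierChar (inner ℝ (r • ξ) (r⁻¹ • (z - u))) • χS (r • ξ) := by
    intro ξ
    simp only [g]
    rw [smul_smul, ← AddChar.map_add_eq_mul]
    congr 2
    rw [inner_smul_left, inner_smul_right, inner_sub_right]
    simp only [conj_trivial]
    field_simp
    ring
  simp_rw [e, hs, Complex.real_smul, inv_pow]

theorem integrable_inv_add_norm_pow_four {r : ℝ} (hr : 0 < r) :
    Integrable fun y : ℝ³ => 1 / (r + ‖y‖) ^ 4 := by
  have h : Integrable fun y : ℝ³ => (1 + ‖y‖) ^ (-(4 : ℝ)) :=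
    integrable_one_add_norm (by simp; norm_num)
  have h2 := (h.comp_smul (inv_ne_zero hr.ne')).const_mul (1 / r ^ 4)
  refine h2.congr (Filter.Eventually.of_forall fun y => ?_)
  have : (0 : ℝ) < r + ‖y‖ := by positivity
  simp only [norm_smul, norm_inv, Real.norm_eq_abs, abs_of_pos hr]
  rw [Real.rpow_neg (by positivity), show (4 : ℝ) = (4 : ℕ) by norm_num, Real.rpow_natCast]
  field_simp

theorem integral_inv_add_norm_pow_four {r : ℝ} (hr : 0 < r) :
    ∫ y : ℝ³, r / (r + ‖y‖) ^ 4 = ∫ y : ℝ³, 1 / (1 + ‖y‖) ^ 4 := by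
  have hs := Measure.integral_comp_inv_smul_of_nonneg (volume : Measure ℝ³)
    (fun y : ℝ³ => 1 / (1 + ‖y‖) ^ 4) hr.le
  rw [finrank_euclideanSpace_fin, smul_eq_mul] at hs
  rw [← mul_right_inj' (pow_ne_zero 3 hr.ne'), ← hs, ← integral_const_mul]
  refine integral_congr_ae (Filter.Eventually.of_forall fun y => ?_)
  have : (0 : ℝ) < r + ‖y‖ := by positivity
  simp only [norm_smul, norm_inv, Real.norm_eq_abs, abs_of_pos hr]
  field_simp

theorem integrable_indicator_ball_inv_norm_sq (r : ℝ) :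
    Integrable ((Metric.ball (0 : ℝ³) r).indicator fun y => 1 / ‖y‖ ^ 2) := by
  rw [integrable_indicator_iff measurableSet_ball,
    integrableOn_fun_norm_addHaar volume (f := fun t : ℝ => 1 / t ^ 2)]
  have h1 : IntegrableOn (fun _ : ℝ => (1 : ℝ)) (Set.Ioo 0 r) := by simp
  refine h1.congr_fun (fun t ht => ?_) measurableSet_Ioo
  have : t ≠ 0 := ht.1.ne'
  simp
  field_simp

theorem integral_indicator_ball_inv_norm_sq {r : ℝ} (hr : 0 < r) :
    ∫ y : ℝ³, (Metric.ball (0 : ℝ³) r).indicator (fun y => 1 / ‖y‖ ^ 2) y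
      = r * ∫ y : ℝ³, (Metric.ball (0 : ℝ³) 1).indicator (fun y => 1 / ‖y‖ ^ 2) y := by
  have hs := Measure.integral_comp_inv_smul_of_nonneg (volume : Measure ℝ³)
    ((Metric.ball (0 : ℝ³) 1).indicator fun y => 1 / ‖y‖ ^ 2) hr.le
  rw [finrank_euclideanSpace_fin, smul_eq_mul] at hs
  rw [← mul_right_inj' (pow_ne_zero 2 hr.ne'), ← mul_assoc, ← pow_succ, ← hs,
    ← integral_const_mul]
  refine integral_congr_ae (Filter.Eventually.of_forall fun y => ?_)
  have hm : r⁻¹ • y ∈ Metric.ball (0 : ℝ³) 1 ↔ y ∈ Metric.ball (0 : ℝ³) r := by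
    rw [mem_ball_zero_iff, mem_ball_zero_iff, norm_smul, norm_inv, Real.norm_of_nonneg hr.le,
      inv_mul_lt_iff₀ hr, mul_one]
  by_cases hy : y ∈ Metric.ball (0 : ℝ³) r
  · simp only [Set.indicator_of_mem hy, Set.indicator_of_mem (hm.2 hy), norm_smul, norm_inv,
      Real.norm_of_nonneg hr.le]
    field_simp
  · simp only [Set.indicator_of_notMem hy, Set.indicator_of_notMem (fun h => hy (hm.1 h)),
      mul_zero]

/-- The averaged function `v ↦ ∫ r (r + |v - u|)⁻⁴ ‖f u‖ du`. -/
def envelope (r : ℝ) (f : ℝ³ → ℂ) (v : ℝ³) : ℝ :=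
  ∫ u, r / (r + ‖v - u‖) ^ 4 * ‖f u‖

theorem integrable_envelope_integrand {r : ℝ} (hr : 0 < r) {f : ℝ³ → ℂ} (hf : Integrable f)
    (v : ℝ³) : Integrable fun u => r / (r + ‖v - u‖) ^ 4 * ‖f u‖ := by
  refine hf.norm.bdd_mul (c := r / r ^ 4) ?_ (Filter.Eventually.of_forall fun u => ?_)
  · refine (Continuous.div (by fun_prop) (by fun_prop) fun u => ?_).aestronglyMeasurable
    positivity
  · rw [Real.norm_of_nonneg (by positivity)]
    gcongr
    linarith [norm_nonneg (v - u)]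

theorem envelope_nonneg {r : ℝ} (hr : 0 < r) (f : ℝ³ → ℂ) (v : ℝ³) : 0 ≤ envelope r f v :=
  integral_nonneg fun u => by positivity

theorem SchwartzMap.exists_second_difference_le {E : Type*} [NormedAddCommGroup E]
    [NormedSpace ℝ E] (f : 𝓢(E, ℂ)) :
    ∃ B : ℝ, 0 ≤ B ∧ ∀ z y : E, ‖f (z - y) + f (z + y) - 2 * f z‖ ≤ B * ‖y‖ ^ 2 := by
  set f1 := SchwartzMap.fderivCLM ℝ E ℂ f
  set f2 := SchwartzMap.fderivCLM ℝ E (E →L[ℝ] ℂ) f1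
  obtain ⟨M, hM, hb⟩ := f2.exists_local_decay 0
  refine ⟨2 * M, by positivity, fun z y => ?_⟩
  have hl (t : ℝ) : HasDerivAt (fun t : ℝ => z + t • y) y t := by
    simpa using ((hasDerivAt_id t).smul_const y).const_add z
  have e1 (t : ℝ) : HasDerivAt (fun t : ℝ => f (z + t • y)) (f1 (z + t • y) y) t :=
    f.differentiableAt.hasFDerivAt.comp_hasDerivAt t (hl t)
  have e2 (t : ℝ) : HasDerivAt (fun t : ℝ => f1 (z + t • y) y) (f2 (z + t • y) y y) t := by
    have := (f1.differentiableAt (x := z + t • y)).hasFDerivAt.hasDerivAt_clm_apply_curve (hl t)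
      (hasDerivAt_const t y)
    rwa [map_zero, add_zero] at this
  have := norm_second_difference_le e1 e2 (M := M * ‖y‖ * ‖y‖) fun t _ =>
    (ContinuousLinearMap.le_opNorm₂ _ _ _).trans (by
      gcongr
      simpa using hb (z + t • y) (z + t • y) (by simp))
  calc _ = ‖f (z + (1 : ℝ) • y) + f (z + (-1 : ℝ) • y) - 2 • f (z + (0 : ℝ) • y)‖ := by
        congr 1
        simp only [one_smul, neg_smul, zero_smul, add_zero, nsmul_eq_mul, Nat.cast_ofNat,
          ← sub_eq_add_neg]
        ring
    _ ≤ _ := this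
    _ = _ := by ring

theorem integrable_mul_dilate (f h : 𝓢(ℝ³, ℂ)) (s : ℝ) (b : ℂ) (z : ℝ³) :
    Integrable fun u => f u * (b * h (s • (z - u))) := by
  obtain ⟨M, hM, hb⟩ := h.exists_local_decay 0
  refine f.integrable.mul_bdd (c := ‖b‖ * M) ?_ (Filter.Eventually.of_forall fun u => ?_)
  · have := h.continuous
    exact (by fun_prop : Continuous fun u => b * h (s • (z - u))).aestronglyMeasurable
  · rw [norm_mul]
    gcongr
    simpa using hb (s • (z - u)) (s • (z - u)) (by simp)

theorem exists_norm_near_difference_le (C₀ : ℝ) (hC₀ : 0 ≤ C₀) (R : ℝ) (hR : 0 < R) :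
    ∃ C : ℝ, 0 ≤ C ∧ ∀ r : ℝ, 0 < r → ∀ ε : ℝ, 0 ≤ ε → ε ≤ 1 / 4 → ∀ f : 𝓢(ℝ³, ℂ),
      (∀ ξ, 𝓕 (⇑f) ξ ≠ 0 → r * ‖ξ‖ ≤ R) → ∀ ψ : ℝ³ → ℝ³, ContDiff ℝ (⊤ : ℕ∞) ψ →
      (∀ x, ‖fderiv ℝ ψ x - ContinuousLinearMap.id ℝ ℝ³‖ ≤ ε) →
      (∀ x, ‖iteratedFDeriv ℝ 2 ψ x‖ ≤ C₀ * r⁻¹ * ε) → ∀ x y : ℝ³, ‖y‖ ≤ r →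
      ‖(f (ψ x + y) + f (ψ x - y)) - (f (ψ (x + y)) + f (ψ (x - y)))‖
        ≤ C * ε * (‖y‖ / r) ^ 2 * envelope r f (ψ x) := by
  obtain ⟨h, hrep⟩ := SchwartzMap.exists_reproducing_kernel R hR
  obtain ⟨C, hC, hcurve⟩ := h.exists_curve_comparison C₀ hC₀
  refine ⟨C, hC, fun r hr ε hε hε4 f hf ψ hψ hψ1 hψ2 x y hy => ?_⟩
  have d1 : Differentiable ℝ ψ := hψ.differentiable (by simp)
  have d2 : Differentiable ℝ (fderiv ℝ ψ) :=
    (hψ.fderiv_right (m := 1) (by norm_cast)).differentiable (by simp)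
  have hη : ‖r⁻¹ • y‖ = ‖y‖ / r := by
    rw [norm_smul, norm_inv, Real.norm_of_nonneg hr.le, inv_mul_eq_div]
  have hl (t : ℝ) : HasDerivAt (fun t : ℝ => x + t • y) y t := by
    simpa using ((hasDerivAt_id t).smul_const y).const_add x
  have hβ (t : ℝ) : HasDerivAt (fun t : ℝ => r⁻¹ • (ψ (x + t • y) - ψ x))
      (r⁻¹ • fderiv ℝ ψ (x + t • y) y) t :=
    (((d1 _).hasFDerivAt.comp_hasDerivAt t (hl t)).sub_const _).fun_const_smul r⁻¹
  have hβ' (t : ℝ) : HasDerivAt (fun t : ℝ => r⁻¹ • fderiv ℝ ψ (x + t • y) y)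
      (r⁻¹ • fderiv ℝ (fderiv ℝ ψ) (x + t • y) y y) t := by
    have := (d2 (x + t • y)).hasFDerivAt.hasDerivAt_clm_apply_curve (hl t) (hasDerivAt_const t y)
    rw [map_zero, add_zero] at this
    exact this.fun_const_smul r⁻¹
  have hβη (t : ℝ) : ‖r⁻¹ • fderiv ℝ ψ (x + t • y) y - r⁻¹ • y‖ ≤ ε * ‖r⁻¹ • y‖ := by
    rw [← smul_sub, norm_smul, norm_smul, mul_left_comm]
    gcongr
    exact ((fderiv ℝ ψ (x + t • y) - ContinuousLinearMap.id ℝ ℝ³).le_opNorm y).trans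
      (by gcongr; exact hψ1 _)
  have hβ'' (t : ℝ) : ‖r⁻¹ • fderiv ℝ (fderiv ℝ ψ) (x + t • y) y y‖
      ≤ C₀ * ε * ‖r⁻¹ • y‖ ^ 2 := by
    have h2 : ‖fderiv ℝ (fderiv ℝ ψ) (x + t • y)‖ ≤ C₀ * r⁻¹ * ε := by
      rw [← norm_iteratedFDeriv_one, norm_iteratedFDeriv_fderiv]
      exact hψ2 _
    rw [hη, norm_smul, norm_inv, Real.norm_of_nonneg hr.le]
    calc _ ≤ r⁻¹ * (C₀ * r⁻¹ * ε * ‖y‖ * ‖y‖) := by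
          gcongr
          exact (ContinuousLinearMap.le_opNorm₂ _ _ _).trans (by gcongr)
      _ = _ := by field_simp
  have hβ0 : (fun t : ℝ => r⁻¹ • (ψ (x + t • y) - ψ x)) 0 = 0 := by simp
  have key (u : ℝ³) := hcurve ε hε hε4 (r⁻¹ • (ψ x - u)) (r⁻¹ • y)
    (by rw [hη]; exact div_le_one_of_le₀ hy hr.le) _ _ _ hβ hβ' hβ0 hβη hβ''
  have i (z : ℝ³) := integrable_mul_dilate f h r⁻¹ (r⁻¹ ^ 3 : ℝ) z
  have i2 (z w : ℝ³) : Integrable fun u => f u * (((r⁻¹ ^ 3 : ℝ) : ℂ) * h (r⁻¹ • (z - u)))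
      + f u * (((r⁻¹ ^ 3 : ℝ) : ℂ) * h (r⁻¹ • (w - u))) := (i z).add (i w)
  rw [hrep r hr f hf (ψ x + y), hrep r hr f hf (ψ x - y), hrep r hr f hf (ψ (x + y)),
    hrep r hr f hf (ψ (x - y)), ← integral_add (i _) (i _), ← integral_add (i _) (i _),
    ← integral_sub (i2 _ _) (i2 _ _), envelope, ← integral_const_mul]
  refine norm_integral_le_of_norm_le
    ((integrable_envelope_integrand hr f.integrable (ψ x)).const_mul _)
    (Filter.Eventually.of_forall fun u => ?_)
  have k := key u
  simp only [one_smul, neg_smul, ← smul_add, ← smul_sub] at k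
  rw [show ψ x - u + y = ψ x + y - u by abel, show ψ x - u - y = ψ x - y - u by abel,
    show ψ x - u + (ψ (x + y) - ψ x) = ψ (x + y) - u by abel,
    show ψ x - u + (ψ (x + -y) - ψ x) = ψ (x - y) - u by rw [sub_eq_add_neg x y]; abel] at k
  have e (A B A' B' : ℂ) : f u * (((r⁻¹ ^ 3 : ℝ) : ℂ) * A) + f u * (((r⁻¹ ^ 3 : ℝ) : ℂ) * B)
      - (f u * (((r⁻¹ ^ 3 : ℝ) : ℂ) * A') + f u * (((r⁻¹ ^ 3 : ℝ) : ℂ) * B'))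
      = f u * (((r⁻¹ ^ 3 : ℝ) : ℂ) * ((A + B) - (A' + B'))) := by ring
  rw [e, norm_mul, norm_mul, Complex.norm_of_nonneg (by positivity)]
  calc _ ≤ ‖f u‖ * (r⁻¹ ^ 3 * (C * ε * ‖r⁻¹ • y‖ ^ 2 / (1 + ‖r⁻¹ • (ψ x - u)‖) ^ 4)) := by
        gcongr
    _ = _ := by
      have : 0 < r + ‖ψ x - u‖ := by positivity
      rw [hη, norm_smul, norm_inv, Real.norm_of_nonneg hr.le]
      field_simp

theorem integrable_KkerReg {c F r : ℝ} (hc : 0 < c) (hF : F ∈ Set.Ioc (0 : ℝ) 1) (hr : 0 < r) :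
    Integrable (KkerReg c F r) := by
  refine ((integrable_inv_add_norm_pow_four hr).const_mul (96 * c / F ^ 3)).mono'
    (continuous_KkerReg c F hr).aestronglyMeasurable (Filter.Eventually.of_forall fun y => ?_)
  rw [mul_one_div]
  exact abs_KkerReg_le hc hF hr y

theorem integrable_KkerReg_mul {c F r : ℝ} (hc : 0 < c) (hF : F ∈ Set.Ioc (0 : ℝ) 1) (hr : 0 < r)
    {g : ℝ³ → ℂ} (hg : Integrable g) {T : ℝ³ → ℝ³} (hT : Continuous T) :
    Integrable fun y => (KkerReg c F r (T y) : ℂ) * g y := by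
  refine hg.bdd_mul (c := 96 * c / F ^ 3 / r ^ 4) ?_ (Filter.Eventually.of_forall fun y => ?_)
  · exact (Complex.continuous_ofReal.comp
      ((continuous_KkerReg c F hr).comp hT)).aestronglyMeasurable
  · have hF0 := hF.1
    rw [Complex.norm_real]
    refine (abs_KkerReg_le hc hF hr _).trans ?_
    gcongr
    linarith [norm_nonneg (T y)]

theorem integrable_KkerReg_mul_add_neg {c F r : ℝ} (hc : 0 < c) (hF : F ∈ Set.Ioc (0 : ℝ) 1)
    (hr : 0 < r) {g : ℝ³ → ℂ} (hg : Integrable g) :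
    Integrable fun y => (KkerReg c F r y : ℂ) * (g (-y) + g y) :=
  integrable_KkerReg_mul hc hF hr (hg.comp_neg.add hg) continuous_id

theorem integral_KkerReg_mul_add_neg {c F r : ℝ} (hc : 0 < c) (hF : F ∈ Set.Ioc (0 : ℝ) 1)
    (hr : 0 < r) {g : ℝ³ → ℂ} (hg : Integrable g) :
    ∫ y, (KkerReg c F r y : ℂ) * (g (-y) + g y) = 2 * ∫ y, (KkerReg c F r y : ℂ) * g y := by
  have h := integral_neg_eq_self (fun y : ℝ³ => (KkerReg c F r y : ℂ) * g y) volume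
  simp only [KkerReg_neg] at h
  have i1 : Integrable fun y => (KkerReg c F r y : ℂ) * g (-y) :=
    integrable_KkerReg_mul hc hF hr hg.comp_neg continuous_id
  have i2 : Integrable fun y => (KkerReg c F r y : ℂ) * g y :=
    integrable_KkerReg_mul hc hF hr hg continuous_id
  simp only [mul_add]
  rw [integral_add i1 i2, h, two_mul]

theorem norm_sub_sub_sub_le_of_fderiv {E : Type*} [NormedAddCommGroup E] [NormedSpace ℝ E]
    {φ : E → E} (hφ : Differentiable ℝ φ) {ε : ℝ}
    (h : ∀ x, ‖fderiv ℝ φ x - ContinuousLinearMap.id ℝ E‖ ≤ ε) (x y : E) :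
    ‖x - y - (φ x - φ y)‖ ≤ ε * ‖x - y‖ := by
  have := Convex.norm_image_sub_le_of_norm_hasFDerivWithin_le (𝕜 := ℝ) (f := fun x => φ x - x)
    (s := Set.univ) (x := y) (y := x) (C := ε)
    (fun z _ => ((hφ z).hasFDerivAt.sub (hasFDerivAt_id z)).hasFDerivWithinAt) (fun z _ => h z)
    convex_univ (Set.mem_univ _) (Set.mem_univ _)
  rwa [show x - y - (φ x - φ y) = -((φ x - x) - (φ y - y)) by abel, norm_neg]

theorem norm_integral_KkerReg_comp_sub_le {c F r ε : ℝ} (hc : 0 < c)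
    (hF : F ∈ Set.Ioc (0 : ℝ) 1) (hr : 0 < r) (hε0 : 0 ≤ ε) (hε : ε ≤ 1 / 4) {f : ℝ³ → ℂ}
    (hf : Integrable f) {ψ φ : ℝ³ → ℝ³} (hψ : Continuous ψ) (hφ : Differentiable ℝ φ)
    (hl : Function.LeftInverse φ ψ) (hri : Function.RightInverse φ ψ)
    (hmp : MeasurePreserving ψ volume volume)
    (hφ1 : ∀ x, ‖fderiv ℝ φ x - ContinuousLinearMap.id ℝ ℝ³‖ ≤ ε) (x : ℝ³) :
    ‖(∫ y, (KkerReg c F r y : ℂ) * f (ψ x + y)) - ∫ y, (KkerReg c F r y : ℂ) * f (ψ (x + y))‖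
      ≤ 8448 * c / F ^ 9 * ε * r⁻¹ * envelope r f (ψ x) := by
  let e : ℝ³ ≃ₜ ℝ³ := ⟨⟨ψ, φ, hl, hri⟩, hψ, hφ.continuous⟩
  have hme : MeasurableEmbedding ψ := e.measurableEmbedding
  have e1 : ∫ y, (KkerReg c F r y : ℂ) * f (ψ x + y)
      = ∫ z, (KkerReg c F r (z - ψ x) : ℂ) * f z := by
    simpa using integral_add_left_eq_self (μ := volume)
      (fun z => (KkerReg c F r (z - ψ x) : ℂ) * f z) (ψ x)
  have e2 : ∫ y, (KkerReg c F r y : ℂ) * f (ψ (x + y))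
      = ∫ z, (KkerReg c F r (φ z - φ (ψ x)) : ℂ) * f z := by
    rw [← hmp.integral_comp hme (fun z => (KkerReg c F r (φ z - φ (ψ x)) : ℂ) * f z)]
    simpa [hl _] using integral_add_left_eq_self (μ := volume)
      (fun w => (KkerReg c F r (w - x) : ℂ) * f (ψ w)) x
  have hφc := hφ.continuous
  rw [e1, e2, ← integral_sub (integrable_KkerReg_mul hc hF hr hf (by fun_prop))
    (integrable_KkerReg_mul hc hF hr hf (by fun_prop)), envelope, ← integral_const_mul]
  refine norm_integral_le_of_norm_le ((integrable_envelope_integrand hr hf (ψ x)).const_mul _)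
    (Filter.Eventually.of_forall fun z => ?_)
  rw [← sub_mul, ← Complex.ofReal_sub, norm_mul, Complex.norm_real, Real.norm_eq_abs, ← mul_assoc]
  gcongr
  refine (abs_KkerReg_sub_le hc hF hr hε0 hε
    (norm_sub_sub_sub_le_of_fderiv hφ hφ1 z (ψ x))).trans_eq ?_
  rw [norm_sub_rev z]
  field_simp

theorem integrable_Kker_mul_second_difference {c F : ℝ} (hc : 0 < c) (hF : F ∈ Set.Ioc (0 : ℝ) 1)
    (f : 𝓢(ℝ³, ℂ)) (z : ℝ³) :
    Integrable fun y => (Kker c F y : ℂ) * (f (z - y) + f (z + y) - 2 * f z) := by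
  have hF0 := hF.1
  obtain ⟨B, hB, hb⟩ := f.exists_second_difference_le
  obtain ⟨M, hM, hm⟩ := f.exists_local_decay 0
  have hm' (w : ℝ³) : ‖f w‖ ≤ M := by simpa using hm w w (by simp)
  have hcont := f.continuous
  have hcont' : Continuous fun y => f (z - y) + f (z + y) - 2 * f z := by fun_prop
  have hbd (y : ℝ³) : ‖f (z - y) + f (z + y) - 2 * f z‖ ≤ 4 * M := by
    refine (norm_sub_le _ _).trans ((add_le_add_left (norm_add_le _ _) _).trans ?_)
    rw [norm_mul, Complex.norm_ofNat]
    linarith [hm' (z - y), hm' (z + y), hm' z]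
  have h1 : Integrable fun y => (KkerReg c F 1 y : ℂ) * (f (z - y) + f (z + y) - 2 * f z) :=
    (integrable_KkerReg hc hF one_pos).ofReal.mul_bdd (c := 4 * M) hcont'.aestronglyMeasurable
      (Filter.Eventually.of_forall hbd)
  have h2 : Integrable fun y => ((Kker c F y - KkerReg c F 1 y : ℝ) : ℂ)
      * (f (z - y) + f (z + y) - 2 * f z) := by
    refine ((integrable_indicator_ball_inv_norm_sq 1).const_mul (12 * c / F ^ 3 * B)).mono' ?_
      (Filter.Eventually.of_forall fun y => ?_)
    · exact (Complex.measurable_ofReal.comp ((measurable_Kker c F).sub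
        (continuous_KkerReg c F one_pos).measurable)).aestronglyMeasurable.mul
        hcont'.aestronglyMeasurable
    · rw [norm_mul, Complex.norm_real]
      refine (mul_le_mul (abs_Kker_sub_KkerReg_le hc hF one_pos y) (hb z y) (norm_nonneg _)
        (Set.indicator_nonneg (fun _ _ => by positivity) _)).trans_eq ?_
      by_cases hy : y ∈ Metric.ball (0 : ℝ³) 1
      · rw [Set.indicator_of_mem hy, Set.indicator_of_mem hy]
        field_simp
      · simp [Set.indicator_of_notMem hy]
  refine (h1.add h2).congr (Filter.Eventually.of_forall fun y => ?_)
  simp only [Pi.add_apply]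
  push_cast
  ring

theorem exists_norm_LambdaInt_commutator_le {c F : ℝ} (hc : 0 < c) (hF : F ∈ Set.Ioc (0 : ℝ) 1)
    (C₀ : ℝ) (hC₀ : 0 ≤ C₀) (R : ℝ) (hR : 0 < R) :
    ∃ C : ℝ, 0 < C ∧ ∀ r : ℝ, 0 < r → ∀ ε : ℝ, 0 ≤ ε → ε ≤ 1 / 4 → ∀ f : 𝓢(ℝ³, ℂ),
      (∀ ξ, 𝓕 (⇑f) ξ ≠ 0 → r * ‖ξ‖ ≤ R) → ∀ ψ φ : ℝ³ → ℝ³, ContDiff ℝ (⊤ : ℕ∞) ψ →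
      Differentiable ℝ φ → Function.LeftInverse φ ψ → Function.RightInverse φ ψ →
      MeasurePreserving ψ volume volume →
      (∀ x, ‖fderiv ℝ ψ x - ContinuousLinearMap.id ℝ ℝ³‖ ≤ ε) →
      (∀ x, ‖fderiv ℝ φ x - ContinuousLinearMap.id ℝ ℝ³‖ ≤ ε) →
      (∀ x, ‖iteratedFDeriv ℝ 2 ψ x‖ ≤ C₀ * r⁻¹ * ε) → ∀ x : ℝ³,
      ‖LambdaInt c F f (ψ x) - LambdaInt c F (f ∘ ψ) x‖ ≤ C * ε * r⁻¹ * envelope r f (ψ x) := by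
  have hF0 := hF.1
  obtain ⟨C, hC, hnear⟩ := exists_norm_near_difference_le C₀ hC₀ R hR
  set I := ∫ y : ℝ³, (Metric.ball (0 : ℝ³) 1).indicator (fun y => 1 / ‖y‖ ^ 2) y with hI
  have hI0 : 0 ≤ I := integral_nonneg fun y => Set.indicator_nonneg (fun _ _ => by positivity) _
  refine ⟨12 * c / F ^ 3 * C * I + 8448 * c / F ^ 9, by positivity,
    fun r hr ε hε hε4 f hf ψ φ hψ hφ hl hri hmp hψ1 hφ1 hψ2 x => ?_⟩
  set G := envelope r f (ψ x)
  have hG : 0 ≤ G := envelope_nonneg hr f (ψ x)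
  let e : ℝ³ ≃ₜ ℝ³ := ⟨⟨ψ, φ, hl, hri⟩, hψ.continuous, hφ.continuous⟩
  have hme : MeasurableEmbedding ψ := e.measurableEmbedding
  have hfi : Integrable f := f.integrable
  have hP : Integrable fun y => f (ψ x + y) := hfi.comp_add_left (ψ x)
  have hQ : Integrable fun y => f (ψ (x + y)) :=
    ((hmp.integrable_comp_emb hme).2 hfi).comp_add_left x
  set d : ℝ³ → ℂ := fun y => (f (ψ x + -y) + f (ψ x + y)) - (f (ψ (x + -y)) + f (ψ (x + y)))
    with hd
  have hcf := f.continuous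
  have hcψ := hψ.continuous
  have hdc : Continuous d := by fun_prop
  have hdr : Integrable fun y => (KkerReg c F r y : ℂ) * d y := by
    simp only [hd, mul_sub]
    exact (integrable_KkerReg_mul_add_neg hc hF hr hP).sub
      (integrable_KkerReg_mul_add_neg hc hF hr hQ)
  have hdrI : ‖∫ y, (KkerReg c F r y : ℂ) * d y‖
      ≤ 2 * (8448 * c / F ^ 9 * ε * r⁻¹ * G) := by
    simp only [hd, mul_sub]
    rw [integral_sub (integrable_KkerReg_mul_add_neg hc hF hr hP)
      (integrable_KkerReg_mul_add_neg hc hF hr hQ), integral_KkerReg_mul_add_neg hc hF hr hP,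
      integral_KkerReg_mul_add_neg hc hF hr hQ, ← mul_sub, norm_mul, Complex.norm_ofNat]
    gcongr
    exact norm_integral_KkerReg_comp_sub_le hc hF hr hε hε4 hfi hcψ hφ hl hri hmp hφ1 x
  set A := 12 * c / F ^ 3 * (C * ε * (1 / r ^ 2) * G) with hA
  have hA0 : 0 ≤ A := by positivity
  have hbound (y : ℝ³) : ‖((Kker c F y - KkerReg c F r y : ℝ) : ℂ) * d y‖
      ≤ A * (Metric.ball (0 : ℝ³) r).indicator (fun y => 1 / ‖y‖ ^ 2) y := by
    rw [norm_mul, Complex.norm_real]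
    have h1 := abs_Kker_sub_KkerReg_le hc hF hr y
    by_cases hy : y ∈ Metric.ball (0 : ℝ³) r
    · rw [Set.indicator_of_mem hy] at h1 ⊢
      have h2 := hnear r hr ε hε hε4 f hf ψ hψ hψ1 hψ2 x y (mem_ball_zero_iff.1 hy).le
      have h3 : ‖d y‖ ≤ C * ε * (‖y‖ / r) ^ 2 * G := by
        convert h2 using 2
        simp only [hd, sub_eq_add_neg]
        ring
      refine (mul_le_mul h1 h3 (norm_nonneg _) (by positivity)).trans_eq ?_
      rw [hA]
      field_simp
    · rw [Set.indicator_of_notMem hy] at h1 ⊢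
      rw [Real.norm_eq_abs, le_antisymm h1 (abs_nonneg _)]
      simp
  have hbi := (integrable_indicator_ball_inv_norm_sq r).const_mul A
  have hd0 : Integrable fun y => ((Kker c F y - KkerReg c F r y : ℝ) : ℂ) * d y := by
    refine hbi.mono' ?_ (Filter.Eventually.of_forall hbound)
    exact (Complex.measurable_ofReal.comp ((measurable_Kker c F).sub
      (continuous_KkerReg c F hr).measurable)).aestronglyMeasurable.mul hdc.aestronglyMeasurable
  have hd0I : ‖∫ y, ((Kker c F y - KkerReg c F r y : ℝ) : ℂ) * d y‖
      ≤ 12 * c / F ^ 3 * C * I * ε * r⁻¹ * G := by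
    refine (norm_integral_le_of_norm_le hbi (Filter.Eventually.of_forall hbound)).trans_eq ?_
    rw [integral_const_mul, integral_indicator_ball_inv_norm_sq hr, ← hI, hA]
    field_simp
  have hK1 := integrable_Kker_mul_second_difference hc hF f (ψ x)
  have hK2 : Integrable fun y =>
      (Kker c F y : ℂ) * ((f ∘ ψ) (x - y) + (f ∘ ψ) (x + y) - 2 * (f ∘ ψ) x) := by
    refine ((hK1.sub hd0).sub hdr).congr (Filter.Eventually.of_forall fun y => ?_)
    simp only [Pi.sub_apply, hd, Function.comp_apply, ← sub_eq_add_neg]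
    push_cast
    ring
  have hsplit : LambdaInt c F f (ψ x) - LambdaInt c F (f ∘ ψ) x
      = (1 / 2 : ℂ) * ((∫ y, ((Kker c F y - KkerReg c F r y : ℝ) : ℂ) * d y)
        + ∫ y, (KkerReg c F r y : ℂ) * d y) := by
    rw [LambdaInt, LambdaInt, ← mul_sub, ← integral_sub hK1 hK2, ← integral_add hd0 hdr]
    congr 2
    funext y
    simp only [hd, Function.comp_apply, ← sub_eq_add_neg]
    push_cast
    ring
  have h12 : ‖(1 / 2 : ℂ)‖ = 1 / 2 := by norm_num
  rw [hsplit, norm_mul, h12]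
  have hX : 0 ≤ 12 * c / F ^ 3 * C * I * ε * r⁻¹ * G := by positivity
  linarith [norm_add_le (∫ y, ((Kker c F y - KkerReg c F r y : ℝ) : ℂ) * d y)
    (∫ y, (KkerReg c F r y : ℂ) * d y)]

theorem eLpNorm_envelope_le {r : ℝ} (hr : 0 < r) {p : ℝ≥0∞} (hp : 1 ≤ p) {f : ℝ³ → ℂ}
    (hf : Integrable f) (hfc : Continuous f) :
    eLpNorm (envelope r f) p volume
      ≤ ENNReal.ofReal (∫ y : ℝ³, 1 / (1 + ‖y‖) ^ 4) * eLpNorm f p volume := by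
  have hk : Measurable fun w : ℝ³ => ENNReal.ofReal (r / (r + ‖w‖) ^ 4) := by fun_prop
  have h := eLpNorm_conv_le (volume : Measure ℝ³) hp hk hfc.enorm.measurable
  have hi : Integrable fun y : ℝ³ => r / (r + ‖y‖) ^ 4 := by
    simpa [div_eq_mul_inv] using (integrable_inv_add_norm_pow_four hr).const_mul r
  rw [← integral_inv_add_norm_pow_four hr, ofReal_integral_eq_lintegral_ofReal hi
    (Filter.Eventually.of_forall fun y => by positivity)]
  calc eLpNorm (envelope r f) p volume
      ≤ eLpNorm (fun v => ∫⁻ u, ENNReal.ofReal (r / (r + ‖v - u‖) ^ 4) * ‖f u‖ₑ) p volume := by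
        refine eLpNorm_mono_enorm fun v => le_of_eq ?_
        rw [Real.enorm_of_nonneg (envelope_nonneg hr f v), envelope,
          ofReal_integral_eq_lintegral_ofReal (integrable_envelope_integrand hr hf v)
            (Filter.Eventually.of_forall fun y => by positivity), enorm_eq_self]
        refine lintegral_congr fun u => ?_
        rw [ENNReal.ofReal_mul (by positivity), ofReal_norm]
    _ ≤ _ := by simpa using h

theorem aestronglyMeasurable_envelope {r : ℝ} {f : ℝ³ → ℂ} (hfc : Continuous f) :
    AEStronglyMeasurable (envelope r f) volume := by
  have : Measurable fun q : ℝ³ × ℝ³ => r / (r + ‖q.1 - q.2‖) ^ 4 * ‖f q.2‖ := by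
    have := hfc.measurable
    fun_prop
  exact this.stronglyMeasurable.integral_prod_right.aestronglyMeasurable

/-- Commutator estimate for `Λ` with a Lagrangian change of variables (Proposition 3.5):
`‖(Λf)∘ψ − Λ(f∘ψ)‖_{L^p} ≤ C e^V (e^V − 1) 2^j ‖f‖_{L^p}` for `f` spectrally supported in the
annulus of size `2^j` and `ψ` a measure-preserving diffeomorphism whose Jacobian satisfies the
stated flow estimates. -/
theorem Lambda_commutator_estimate
    (F : ℝ) (hF : F ∈ Set.Ioc (0 : ℝ) 1)
    (c : ℝ) (hc : 0 < c)
    -- `c` is the universal constant making the singular-integral form of `Λ` agree with the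
    -- Fourier multiplier definition on Schwartz functions
    (hrep : ∀ f : 𝓢(EuclideanSpace ℝ (Fin 3), ℂ), ∀ x : EuclideanSpace ℝ (Fin 3),
      LambdaFourier F ⇑f x = LambdaInt c F ⇑f x)
    (C₀ : ℝ) (hC₀ : 0 < C₀) :
    ∃ C > (0 : ℝ), ∀ (j : ℤ) (p : ℝ≥0∞), 1 ≤ p →
      ∀ V : ℝ, 0 ≤ V → Real.exp (2 * V) - 1 ≤ 1 / 2 →
      ∀ f : 𝓢(EuclideanSpace ℝ (Fin 3), ℂ),
        (Function.support (𝓕 ⇑f) ⊆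
          {ξ : EuclideanSpace ℝ (Fin 3) |
            3 / 4 * (2 : ℝ) ^ j ≤ ‖ξ‖ ∧ ‖ξ‖ ≤ 8 / 3 * (2 : ℝ) ^ j}) →
      ∀ ψ φ : EuclideanSpace ℝ (Fin 3) → EuclideanSpace ℝ (Fin 3),
        ContDiff ℝ (⊤ : ℕ∞) ψ → ContDiff ℝ (⊤ : ℕ∞) φ →
        Function.LeftInverse φ ψ → Function.RightInverse φ ψ →
        MeasurePreserving ψ (volume : Measure (EuclideanSpace ℝ (Fin 3))) volume →
        (∀ x, ‖fderiv ℝ ψ x‖ ≤ Real.exp V) →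
        (∀ x, ‖fderiv ℝ φ x‖ ≤ Real.exp V) →
        (∀ x, ‖fderiv ℝ ψ x - ContinuousLinearMap.id ℝ (EuclideanSpace ℝ (Fin 3))‖ ≤
          Real.exp V - 1) →
        (∀ x, ‖fderiv ℝ φ x - ContinuousLinearMap.id ℝ (EuclideanSpace ℝ (Fin 3))‖ ≤
          Real.exp V - 1) →
        (∀ x, ‖iteratedFDeriv ℝ 2 ψ x‖ ≤ C₀ * (2 : ℝ) ^ j * (Real.exp V - 1)) →
        (∀ x, ‖iteratedFDeriv ℝ 2 φ x‖ ≤ C₀ * (2 : ℝ) ^ j * (Real.exp V - 1)) →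
        eLpNorm (fun x => LambdaInt c F ⇑f (ψ x) - LambdaInt c F (⇑f ∘ ψ) x) p volume ≤
          ENNReal.ofReal (C * Real.exp V * (Real.exp V - 1) * (2 : ℝ) ^ j) *
            eLpNorm ⇑f p volume := by
  obtain ⟨C, hC, hpt⟩ :=
    exists_norm_LambdaInt_commutator_le hc hF C₀ hC₀.le (8 / 3) (by norm_num)
  have hJ : 0 ≤ ∫ y : EuclideanSpace ℝ (Fin 3), 1 / (1 + ‖y‖) ^ 4 :=
    integral_nonneg fun y => by positivity
  set J := ∫ y : EuclideanSpace ℝ (Fin 3), 1 / (1 + ‖y‖) ^ 4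
  refine ⟨C * (J + 1), by positivity, fun j p hp V hV hV2 f hf ψ φ hψ hφ hl hri hmp _ _ hψ1 hφ1
    hψ2 _ => ?_⟩
  have hε0 : 0 ≤ Real.exp V - 1 := sub_nonneg.2 (Real.one_le_exp hV)
  have hε : Real.exp V - 1 ≤ 1 / 4 := by
    rw [two_mul, Real.exp_add] at hV2
    nlinarith
  have h2 : (0 : ℝ) < 2 ^ j := by positivity
  have hspec (ξ : EuclideanSpace ℝ (Fin 3)) (hξ : 𝓕 (⇑f) ξ ≠ 0) :
      ((2 : ℝ) ^ j)⁻¹ * ‖ξ‖ ≤ 8 / 3 := by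
    rw [inv_mul_le_iff₀ h2, mul_comm]
    exact (hf hξ).2
  have hb (x : EuclideanSpace ℝ (Fin 3)) := hpt _ (inv_pos.2 h2) _ hε0 hε f hspec ψ φ hψ
    (hφ.differentiable (by simp)) hl hri hmp hψ1 hφ1 (by rwa [inv_inv]) x
  rw [inv_inv] at hb
  set G := envelope ((2 : ℝ) ^ j)⁻¹ f
  calc _ ≤ eLpNorm ((C * (Real.exp V - 1) * 2 ^ j) • (G ∘ ψ)) p volume :=
        eLpNorm_mono_real fun x => hb x
    _ = ENNReal.ofReal (C * (Real.exp V - 1) * 2 ^ j) * eLpNorm G p volume := by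
        rw [eLpNorm_const_smul, Real.enorm_of_nonneg (by positivity),
          eLpNorm_comp_measurePreserving (aestronglyMeasurable_envelope f.continuous) hmp]
    _ ≤ ENNReal.ofReal (C * (Real.exp V - 1) * 2 ^ j) *
        (ENNReal.ofReal J * eLpNorm f p volume) := by
        gcongr
        exact eLpNorm_envelope_le (inv_pos.2 h2) hp f.integrable f.continuous
    _ ≤ _ := by
        rw [← mul_assoc, ← ENNReal.ofReal_mul (by positivity)]
        gcongr ENNReal.ofReal ?_ * _
        calc C * (Real.exp V - 1) * 2 ^ j * J = C * J * 1 * (Real.exp V - 1) * 2 ^ j := by ring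
          _ ≤ _ := by
            gcongr
            · linarith
            · exact Real.one_le_exp hV
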